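/- For every even integer n ≥ 4, the polynomial identity B_n(x) = C_n + x²·B_{n−2}(x) + x² · Σ_{i even, 4 ≤ i ≤ n−2} C_i · ( B_{n−i}(x) + x^{n−i−2} ) holds, where B_0(x) = B_2(x) = 0. -/

import Mathlib

/-- `C_{2r} = 2·((r−1)!)²/(2r)!` for `r ≥ 1`, the Taylor coefficients of
`4·arcsin(z/2)² = Σ_{r≥1} C_{2r} z^{2r}`. -/
noncomputable def Ccoef (m : ℕ) : ℝ :=
  2 * ((m / 2 - 1).factorial : ℝ) ^ 2 / (m.factorial : ℝ)

/-- `B_n(x) = Σ x^{2k−2}·Π_{j=1}^k C_{2 i_j}`, the sum over all `k ≥ 1` and all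
compositions `(i_1,…,i_k)` of `n/2` into positive parts other than the all-ones
composition (so `B_0 = B_2 = 0`). -/
noncomputable def Bfun (n : ℕ) (x : ℝ) : ℝ :=
  ∑ᶠ p ∈ {p : Σ k : ℕ, Fin k → ℕ |
      1 ≤ p.1 ∧ (∀ j, 0 < p.2 j) ∧ (∑ j, p.2 j) = n / 2 ∧ p.2 ≠ fun _ => 1},
    x ^ (2 * p.1 - 2) * ∏ j, Ccoef (2 * p.2 j)


def Lc (m : ℕ) : Finset (List ℕ) := (Finset.univ : Finset (Composition m)).image Composition.blocks

lemma mem_Lc (m : ℕ) (l : List ℕ) : l ∈ Lc m ↔ (∀ a ∈ l, 0 < a) ∧ l.sum = m := by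
  unfold Lc
  simp only [Finset.mem_image, Finset.mem_univ, true_and]
  constructor
  · rintro ⟨c, rfl⟩
    exact ⟨fun a h => c.blocks_pos h, c.blocks_sum⟩
  · rintro ⟨h1, h2⟩
    exact ⟨⟨l, fun {i} hi => h1 i hi, h2⟩, rfl⟩

lemma Lc_zero : Lc 0 = {[]} := by
  ext l
  rw [mem_Lc]
  cases l with
  | nil => simp
  | cons a t => simp; omega

lemma Lc_pos (m : ℕ) (hm : 0 < m) :
    Lc m = (Finset.Icc 1 m).biUnion (fun i => (Lc (m - i)).image (List.cons i)) := by
  ext l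
  simp only [Finset.mem_biUnion, Finset.mem_image, mem_Lc, Finset.mem_Icc]
  constructor
  · rintro ⟨h1, h2⟩
    cases l with
    | nil => simp at h2; omega
    | cons a t =>
      simp at h1 h2
      exact ⟨a, ⟨h1.1, by omega⟩, t, ⟨h1.2, by omega⟩, rfl⟩
  · rintro ⟨i, ⟨h1, h2⟩, t, ⟨h3, h4⟩, rfl⟩
    simp
    exact ⟨⟨by omega, h3⟩, by omega⟩

noncomputable def wt (x : ℝ) (l : List ℕ) : ℝ :=
  x ^ (2 * l.length - 2) * (l.map (fun a => Ccoef (2 * a))).prod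

noncomputable def Fs (x : ℝ) (m : ℕ) : ℝ := ∑ l ∈ Lc m, wt x l

lemma Fs_rec (x : ℝ) (m : ℕ) (hm : 0 < m) :
    Fs x m = Ccoef (2 * m) + x ^ 2 * ∑ i ∈ Finset.Ico 1 m, Ccoef (2 * i) * Fs x (m - i) := by
  have key : ∀ i, ∑ l ∈ (Lc (m - i)).image (List.cons i), wt x l
      = ∑ l ∈ Lc (m - i), wt x (i :: l) := fun i =>
    Finset.sum_image (by intro a _ b _ h; simpa using h)
  unfold Fs
  rw [Lc_pos m hm, Finset.sum_biUnion]
  · simp only [key]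
    rw [← Finset.Ico_insert_right (by omega : 1 ≤ m), Finset.sum_insert (by simp)]
    congr 1
    · simp [Lc_zero, wt]
    · rw [Finset.mul_sum]
      refine Finset.sum_congr rfl fun i hi => ?_
      rw [Finset.mem_Ico] at hi
      rw [Finset.mul_sum, Finset.mul_sum]
      refine Finset.sum_congr rfl fun l hl => ?_
      rw [mem_Lc] at hl
      cases l with
      | nil => simp at hl; omega
      | cons a t =>
        simp only [wt, List.length_cons, List.map_cons, List.prod_cons]
        rw [show 2 * (t.length + 1 + 1) - 2 = 2 + (2 * (t.length + 1) - 2) by omega, pow_add]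
        ring
  · intro i _ j _ hij
    simp only [Function.onFun]
    rw [Finset.disjoint_left]
    intro l h1 h2
    simp only [Finset.mem_image] at h1 h2
    obtain ⟨a, _, rfl⟩ := h1
    obtain ⟨b, _, h⟩ := h2
    simp at h
    exact hij h.1.symm

lemma Ccoef_two : Ccoef 2 = 1 := by norm_num [Ccoef]

lemma Bfun_eq (x : ℝ) (m : ℕ) (hm : 0 < m) :
    Bfun (2 * m) x = Fs x m - x ^ (2 * m - 2) := by
  have h1 : Bfun (2 * m) x = ∑ᶠ l ∈ (((Lc m).erase (List.replicate m 1) : Finset (List ℕ)) : Set (List ℕ)), wt x l := by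
    unfold Bfun
    refine finsum_mem_eq_of_bijOn (fun p => List.ofFn p.2) ?_ ?_
    · have hinj : Function.Injective (fun p : Σ k : ℕ, Fin k → ℕ => List.ofFn p.2) :=
        List.equivSigmaTuple.symm.injective
      refine ⟨?_, hinj.injOn, ?_⟩
      · rintro ⟨k, f⟩ ⟨hk, hp, hs, hne⟩
        simp only [Finset.coe_erase, Set.mem_diff, Finset.mem_coe, mem_Lc, Set.mem_singleton_iff]
        refine ⟨⟨?_, ?_⟩, ?_⟩
        · intro a ha
          rw [List.mem_ofFn] at ha
          obtain ⟨j, rfl⟩ := ha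
          exact hp j
        · rw [List.sum_ofFn]; simpa using hs
        · intro h
          apply hne
          funext j
          have : f j ∈ List.ofFn f := by rw [List.mem_ofFn]; exact ⟨j, rfl⟩
          rw [h] at this
          exact List.eq_of_mem_replicate this
      · intro l hl
        simp only [Finset.coe_erase, Set.mem_diff, Finset.mem_coe, mem_Lc, Set.mem_singleton_iff] at hl
        obtain ⟨⟨hp, hs⟩, hne⟩ := hl
        refine ⟨⟨l.length, l.get⟩, ⟨?_, ?_, ?_, ?_⟩, List.ofFn_get l⟩
        · rcases l with _ | ⟨a, t⟩
          · simp at hs; omega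
          · simp
        · intro j; exact hp _ (List.get_mem _ _)
        · have : (List.ofFn l.get).sum = m := by rw [List.ofFn_get]; exact hs
          rw [List.sum_ofFn] at this
          simpa using this
        · intro h
          apply hne
          have h2 : l = List.replicate l.length 1 := by
            conv_lhs => rw [← List.ofFn_get l]
            simp only at h
            rw [h, List.ofFn_const]
          have h3 : l.length = m := by
            rw [h2] at hs; simpa using hs
          rw [h3] at h2; exact h2
    · rintro ⟨k, f⟩ _
      simp [wt, List.map_ofFn, List.prod_ofFn]
  rw [h1, finsum_mem_coe_finset, Fs]
  have hm' : List.replicate m 1 ∈ Lc m := by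
    rw [mem_Lc]; simp +contextual
  rw [← Finset.sum_erase_add _ _ hm']
  simp [wt, Ccoef_two]

/-- for every even `n ≥ 4`,
`B_n(x) = C_n + x²·B_{n−2}(x) + x²·Σ_{i even, 4 ≤ i ≤ n−2} C_i·(B_{n−i}(x) + x^{n−i−2})`. -/
theorem Bfun_recursion (n : ℕ) (hn : 4 ≤ n) (hne : Even n) (x : ℝ) :
    Bfun n x = Ccoef n + x ^ 2 * Bfun (n - 2) x +
      x ^ 2 * ∑ i ∈ (Finset.Icc 4 (n - 2)).filter (fun i => Even i),
        Ccoef i * (Bfun (n - i) x + x ^ (n - i - 2)) := by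
  obtain ⟨m, rfl⟩ := hne
  rw [← two_mul] at *
  have hm : 2 ≤ m := by omega
  have hs : (Finset.Icc 4 (2 * m - 2)).filter (fun i => Even i)
      = (Finset.Ico 2 m).image (fun i => 2 * i) := by
    ext i
    simp only [Finset.mem_filter, Finset.mem_Icc, Finset.mem_image, Finset.mem_Ico]
    constructor
    · rintro ⟨h, k, rfl⟩
      exact ⟨k, by omega, by omega⟩
    · rintro ⟨k, h, rfl⟩
      exact ⟨by omega, by simp⟩
  rw [hs, Finset.sum_image (by intro a _ b _ h; simpa using h),
    show 2 * m - 2 = 2 * (m - 1) by omega, Bfun_eq x m (by omega), Bfun_eq x (m - 1) (by omega),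
    Fs_rec x m (by omega), Finset.sum_eq_sum_Ico_succ_bot (by omega : 1 < m)]
  have h : ∀ i ∈ Finset.Ico 2 m, Ccoef (2 * i) * (Bfun (2 * m - 2 * i) x + x ^ (2 * m - 2 * i - 2))
      = Ccoef (2 * i) * Fs x (m - i) := by
    intro i hi
    rw [Finset.mem_Ico] at hi
    rw [show 2 * m - 2 * i = 2 * (m - i) by omega, Bfun_eq x (m - i) (by omega)]
    ring
  rw [Finset.sum_congr rfl h, show 2 * m - 2 = 2 + (2 * (m - 1) - 2) by omega, pow_add,
    show 2 * 1 = 2 from rfl, Ccoef_two]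
  ring
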